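/- Let n > 10 be an integer, p > p_c and α > 0. Suppose v₀ : [0,∞) → ℝ is continuous with 0 ≤ v₀(r) ≤ L r^{−ν} for all r > 0 and v₀(r) ≥ φ_α(r) + b(r+1)^{−γ} for all r ≥ 0, with some b > 0 and γ ∈ (ν+λ₁, (n−2)/2). Then there exists c > 0 such that every bounded classical radial solution v of (v^p)_t = v_rr + ((n−1)/r)v_r + v^p with initial data v₀ satisfies v(0,t) − φ_α(0) ≥ c e^{−κ(γ) t} for all t ≥ 0, where κ(γ) := γ(n−2−γ)/(pL^{p−1}) − 1. -/

import Mathlib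

noncomputable section

open Real Filter Set Asymptotics

/-- `ν = 2/(p-1)`. -/
def nuExp (p : ℝ) : ℝ := 2 / (p - 1)

/-- `L = (ν(n−2−ν))^{1/(p−1)}`. -/
def Lconst (n : ℕ) (p : ℝ) : ℝ := (nuExp p * ((n : ℝ) - 2 - nuExp p)) ^ (1 / (p - 1))

/-- The critical exponent `p_c` for `n > 10`. -/
def pc (n : ℕ) : ℝ :=
  (((n : ℝ) - 2) ^ 2 - 4 * (n : ℝ) + 8 * Real.sqrt ((n : ℝ) - 1)) /
    (((n : ℝ) - 2) * ((n : ℝ) - 10))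

/-- `λ₁ = (n−2−2ν − √((n−2−2ν)² − 8(n−2−ν)))/2`. -/
def lam1 (n : ℕ) (p : ℝ) : ℝ :=
  (((n : ℝ) - 2 - 2 * nuExp p) -
    Real.sqrt (((n : ℝ) - 2 - 2 * nuExp p) ^ 2 - 8 * ((n : ℝ) - 2 - nuExp p))) / 2

/-- `κ(γ) = γ(n−2−γ)/(pL^{p−1}) − 1`. -/
def kappaOf (n : ℕ) (p γ : ℝ) : ℝ :=
  γ * ((n : ℝ) - 2 - γ) / (p * Lconst n p ^ (p - 1)) - 1

/-- `φ` is the (radial profile of the) positive steady state `φ_α` of `Δφ + φ^p = 0`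
with `φ(0) = α`, `φ'(0) = 0`, together with its properties in the supercritical range
`n > 10`, `p > p_c`: positivity, strict monotonicity, the bound `φ(r) ≤ L r^{−ν}`, and the
asymptotic expansion `φ(r) = L r^{−ν} − a r^{−ν−λ₁} + o(r^{−ν−λ₁})` with coefficient `a > 0`. -/
structure IsSteadyStateA (n : ℕ) (p α : ℝ) (φ : ℝ → ℝ) (a : ℝ) : Prop where
  cont : ContinuousOn φ (Set.Ici 0)
  smooth : ContDiffOn ℝ 2 φ (Set.Ioi 0)
  ode : ∀ r > (0 : ℝ), deriv (deriv φ) r + ((n : ℝ) - 1) / r * deriv φ r + φ r ^ p = 0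
  val0 : φ 0 = α
  deriv0 : derivWithin φ (Set.Ici 0) 0 = 0
  pos : ∀ r ≥ (0 : ℝ), 0 < φ r
  anti : StrictAntiOn φ (Set.Ici 0)
  upper : ∀ r > (0 : ℝ), φ r ≤ Lconst n p * r ^ (-nuExp p)
  a_pos : 0 < a
  expansion :
    (fun r => φ r - (Lconst n p * r ^ (-nuExp p) - a * r ^ (-nuExp p - lam1 n p)))
      =o[atTop] fun r => r ^ (-nuExp p - lam1 n p)

/-- `v` is a bounded classical radial solution of
`(v^p)_t = v_rr + ((n−1)/r) v_r + v^p` with initial data `v₀ : [0,∞) → ℝ`: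
nonnegative and continuous on `[0,∞) × [0,∞)`, bounded on `[0,∞) × [0,T]` for every
`T > 0`, `C²` in `r` and `C¹` in `t` for `t > 0` with `∂_r v(0,t) = 0`, satisfying the
equation pointwise for `r > 0`, `t > 0`, and attaining the initial data. -/
structure IsRadialSol (n : ℕ) (p : ℝ) (v : ℝ → ℝ → ℝ) (v₀ : ℝ → ℝ) : Prop where
  nonneg : ∀ r ≥ (0 : ℝ), ∀ t ≥ (0 : ℝ), 0 ≤ v r t
  cont : ContinuousOn (fun q : ℝ × ℝ => v q.1 q.2) (Set.Ici 0 ×ˢ Set.Ici 0)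
  bdd : ∀ T > (0 : ℝ), ∃ M, ∀ r ≥ (0 : ℝ), ∀ t ∈ Set.Icc (0 : ℝ) T, v r t ≤ M
  smooth_r : ∀ t > (0 : ℝ), ContDiffOn ℝ 2 (fun r => v r t) (Set.Ici 0)
  smooth_t : ∀ r ≥ (0 : ℝ), ContDiffOn ℝ 1 (fun s => v r s ^ p) (Set.Ioi (0 : ℝ))
  slope0 : ∀ t > (0 : ℝ), derivWithin (fun r => v r t) (Set.Ici 0) 0 = 0
  pde : ∀ r > (0 : ℝ), ∀ t > (0 : ℝ),
    deriv (fun s => v r s ^ p) t =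
      deriv (deriv fun ρ => v ρ t) r + ((n : ℝ) - 1) / r * deriv (fun ρ => v ρ t) r
        + v r t ^ p
  init : ∀ r ≥ (0 : ℝ), v r 0 = v₀ r


theorem aux_second_deriv {f f1 : ℝ → ℝ} {f2 r : ℝ}
    (h : ∀ᶠ s in nhds r, HasDerivAt f (f1 s) s) (h2 : HasDerivAt f1 f2 r)
    (hmin : IsLocalMin f r) : f1 r = 0 ∧ 0 ≤ f2 := by
  have h0 : f1 r = 0 := hmin.hasDerivAt_eq_zero h.self_of_nhds
  refine ⟨h0, ?_⟩
  by_contra hneg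
  push Not at hneg
  have hd : deriv f =ᶠ[nhds r] f1 := h.mono fun s hs => hs.deriv
  have hmax : IsLocalMax f r := by
    apply isLocalMax_of_deriv_deriv_neg
    · rw [hd.deriv_eq, h2.deriv]; exact hneg
    · rw [hd.self_of_nhds, h0]
    · exact h.self_of_nhds.continuousAt
  have hc : f =ᶠ[nhds r] fun _ => f r := by
    filter_upwards [hmin, hmax] with s a b
    exact le_antisymm b a
  have hd0 : deriv f =ᶠ[nhds r] fun _ => (0:ℝ) := by
    have := hc.deriv
    simpa using this
  have : deriv f1 r = 0 := by
    rw [(hd.symm.trans hd0).deriv_eq]; simp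
  rw [h2.deriv] at this
  linarith

theorem aux_left_deriv {g : ℝ → ℝ} {d t : ℝ} (h : HasDerivAt g d t) (h0 : g t = 0)
    (hg : ∀ᶠ s in nhdsWithin t (Set.Iio t), 0 ≤ g s) : d ≤ 0 := by
  have h1 := (hasDerivWithinAt_iff_tendsto_slope' (s := Set.Iio t) (by simp)).1
    (h.hasDerivWithinAt (s := Set.Iio t))
  refine le_of_tendsto h1 ?_
  filter_upwards [hg, self_mem_nhdsWithin] with s hs hst
  have hst' : s < t := hst
  rw [slope_def_field, h0]
  apply div_nonpos_of_nonneg_of_nonpos <;> linarith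

theorem aux_right_deriv {g : ℝ → ℝ} {d t : ℝ} (h : HasDerivWithinAt g d (Set.Ici t) t)
    (hg : ∀ᶠ s in nhdsWithin t (Set.Ioi t), g t ≤ g s) : 0 ≤ d := by
  have h1 := (hasDerivWithinAt_iff_tendsto_slope' (s := Set.Ioi t) (by simp)).1
    (h.mono Set.Ioi_subset_Ici_self)
  refine ge_of_tendsto h1 ?_
  filter_upwards [hg, self_mem_nhdsWithin] with s hs hst
  have hst' : t < s := hst
  rw [slope_def_field]
  apply div_nonneg <;> linarith

set_option maxHeartbeats 1000000 in
theorem aux_gap (n p κ c1 C2 C3 R2 : ℝ) (hn : 0 < n) (hp : 1 < p) (hκ : 0 < κ)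
    (hc1 : 0 < c1) (hC2 : 0 < C2) (hC3 : 0 ≤ C3) (hR2 : 1 ≤ R2) :
    ∃ c > 0, ∃ s₀ > 0, ∀ δ Q r z w Lap zr : ℝ, 0 < δ → δ ≤ s₀ → δ ≤ Q →
      Q * (1 + R2 ^ 2) ≤ 1 / 2 → 0 < r → 0 < w → w ≤ z →
      c1 ≤ z ^ (p - 1) * (1 + r ^ 2) → z ^ (p - 1) * (1 + r ^ 2) ≤ C2 →
      -z ^ p - κ * p * z ^ (p - 1) * w ≤ Lap → zr ≤ C3 * z → (R2 ≤ r → zr ≤ 0) →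
      Q * (1 + r ^ 2) < 1 → 0 ≤ (1 - Q * (1 + r ^ 2)) ^ 2 - δ →
      Lap * ((1 - Q * (1 + r ^ 2)) ^ 2 - δ) + 2 * zr * (-(4 * (1 - Q * (1 + r ^ 2)) * (Q * r)))
        + z * (8 * (Q * r) ^ 2 - 4 * n * Q * (1 - Q * (1 + r ^ 2)))
        + (z * ((1 - Q * (1 + r ^ 2)) ^ 2 - δ)) ^ p ≤
        p * (z * ((1 - Q * (1 + r ^ 2)) ^ 2 - δ)) ^ (p - 1) *
          (-κ * w * ((1 - Q * (1 + r ^ 2)) ^ 2 - δ)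
            + z * (-(2 * (1 - Q * (1 + r ^ 2)) * (c * (Q * (1 + r ^ 2)))))) → False := by
  set B := (1 + κ * p) * C2 with hB
  have hBpos : 0 < B := by positivity
  set s := 1 / (2 * (B + 4 * n + 1)) with hs
  have hspos : 0 < s := by positivity
  have hsB : s * (B + 4 * n + 1) = 1 / 2 := by rw [hs]; field_simp
  have hs2 : s ≤ 1 / 2 := by nlinarith only [hsB, hspos, hBpos, hn, mul_pos hspos hBpos, mul_pos hspos hn]
  set μ0 := (s ^ 2 / 2) ^ (p - 1) with hμ0
  have hμ0pos : 0 < μ0 := by positivity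
  set C4 := 4 * C3 * (1 + R2 ^ 2) + 4 * n with hC4
  have hC4pos : 0 < C4 := by positivity
  set c := (3 * (p - 1) / s * B + C4 + 1) / (2 * p * μ0 * c1) with hc
  have hp1 : 0 < p - 1 := by linarith
  have hcpos : 0 < c := by positivity
  have hcc : 2 * p * c * μ0 * c1 = 3 * (p - 1) / s * B + C4 + 1 := by
    rw [hc]; field_simp
  refine ⟨c, hcpos, s ^ 2 / 2, by positivity, ?_⟩
  intro δ Q r z w Lap zr hδ hδs hδQ hQR hr hw hwz hY1 hY2 hLap hzr hzr0 hq1 hm H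
  have hQ : 0 < Q := lt_of_lt_of_le hδ hδQ
  set q := Q * (1 + r ^ 2) with hq
  have hqQ : Q ≤ q := by rw [hq]; nlinarith only [mul_nonneg hQ.le (sq_nonneg r)]
  have hq0 : 0 < q := by linarith
  set m := (1 - q) ^ 2 - δ with hmdef
  have hz : 0 < z := by linarith
  set N := z ^ (p - 1) with hN
  have hNpos : 0 < N := by positivity
  set μ := m ^ (p - 1) with hμ
  have hm1 : m < 1 := by
    have h1 : (1 - q) ^ 2 ≤ 1 := pow_le_one₀ (by linarith) (by linarith)
    rw [hmdef]; linarith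
  have hμnn : 0 ≤ μ := by positivity
  have hμ1 : μ ≤ 1 := Real.rpow_le_one hm hm1.le hp1.le
  have e1 : z ^ p = N * z := by
    rw [hN, ← Real.rpow_add_one hz.ne']; congr 1; ring
  have e2 : m ^ p = μ * m := by
    rcases hm.eq_or_lt with h | h
    · rw [← h, Real.zero_rpow (by linarith)]; simp
    · rw [hμ, ← Real.rpow_add_one h.ne']; congr 1; ring
  rw [Real.mul_rpow hz.le hm, Real.mul_rpow hz.le hm, e1, e2, ← hN, ← hμ] at H
  rw [e1] at hLap
  have h1q : 0 < 1 - q := by linarith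
  -- reduce
  have hL2 : (-(N * z) - κ * p * N * w) * m ≤ Lap * m := mul_le_mul_of_nonneg_right hLap hm
  have hw2 : κ * p * (1 - μ) * m * N * w ≤ κ * p * (1 - μ) * m * N * z := by
    apply mul_le_mul_of_nonneg_left hwz
    have : 0 ≤ 1 - μ := by linarith
    positivity
  have main : 8 * zr * ((1 - q) * (Q * r)) + (1 + κ * p) * ((1 - μ) * m) * N * z
      + z * (4 * n * Q * (1 - q)) ≥ z * (8 * (Q * r) ^ 2) + 2 * p * c * N * μ * z * q * (1 - q) := by
    linarith
  -- zr bound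
  have hY2' : (1 + κ * p) * (N * (1 + r ^ 2)) ≤ B := by
    rw [hB]; exact mul_le_mul_of_nonneg_left hY2 (by positivity)
  have hrr : 0 < 1 + r ^ 2 := by positivity
  have hμm : 0 ≤ (1 - μ) * m := mul_nonneg (by linarith) hm
  have hQr : Q * r ≤ q / 2 := by rw [hq]; nlinarith only [mul_nonneg hQ.le (sq_nonneg (r - 1))]
  by_cases hcase : 1 - q < s
  · -- region A
    have hRr : R2 ≤ r := by
      by_contra hlt
      push Not at hlt
      have : q ≤ Q * (1 + R2 ^ 2) := by
        rw [hq]; apply mul_le_mul_of_nonneg_left _ hQ.le; nlinarith only [hlt, hr]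
      linarith
    have hz0 := hzr0 hRr
    have h8 : 8 * zr * ((1 - q) * (Q * r)) ≤ 0 := by
      have : 0 ≤ (1 - q) * (Q * r) := by positivity
      nlinarith only [this, hz0]
    have main2 : (1 + κ * p) * ((1 - μ) * m) * N + (4 * n * Q * (1 - q)) ≥ (8 * (Q * r) ^ 2) := by
      have h9 : 0 ≤ 2 * p * c * N * μ * z * q * (1 - q) := by positivity
      have : z * (8 * (Q * r) ^ 2) ≤ z * ((1 + κ * p) * ((1 - μ) * m) * N + (4 * n * Q * (1 - q))) := by
        linarith
      exact le_of_mul_le_mul_left this hz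
    have main3 : ((1 - μ) * m) * ((1 + κ * p) * (N * (1 + r ^ 2))) + 4 * n * q * (1 - q)
        ≥ 8 * (Q * r) ^ 2 * (1 + r ^ 2) := by
      have := mul_le_mul_of_nonneg_right main2 hrr.le
      have e4 : 4 * n * Q * (1 - q) * (1 + r ^ 2) = 4 * n * q * (1 - q) := by rw [hq]; ring
      linarith
    have h10 : ((1 - μ) * m) * ((1 + κ * p) * (N * (1 + r ^ 2))) ≤ s * B := by
      have : (1 - μ) * m ≤ s := by
        have i1 : (1 - μ) * m ≤ 1 * m := mul_le_mul_of_nonneg_right (by linarith) hm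
        have i2 : m ≤ s := by rw [hmdef]; nlinarith only [h1q, hcase, hδ, hq0]
        linarith
      exact mul_le_mul this hY2' (by positivity) hspos.le
    have h11 : 4 * n * q * (1 - q) ≤ 4 * n * s := by
      have : q * (1 - q) ≤ 1 * s := mul_le_mul hq1.le hcase.le h1q.le (by norm_num)
      nlinarith only [this, hn]
    have hr1 : 1 ≤ r := by linarith
    have h12 : 8 * (Q * r) ^ 2 * (1 + r ^ 2) ≥ 1 := by
      have e : 4 * q ^ 2 ≤ 8 * (Q * r) ^ 2 * (1 + r ^ 2) := by
        have : 0 ≤ Q ^ 2 * (1 + r ^ 2) * (r ^ 2 - 1) := by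
          have : 0 ≤ r ^ 2 - 1 := by nlinarith only [hr1]
          positivity
        rw [hq]; linarith
      have : 1 / 2 ≤ q := by linarith
      nlinarith only [this, e]
    linarith
  · -- region B
    push Not at hcase
    have hmlow : s ^ 2 / 2 ≤ m := by rw [hmdef]; nlinarith only [hcase, hspos, hδs]
    have hμlow : μ0 ≤ μ := Real.rpow_le_rpow (by positivity) hmlow hp1.le
    have hbern : (1 - μ) * m ≤ (p - 1) * (3 * q) := by
      have := one_add_mul_self_le_rpow_one_add (s := m - 1) (by linarith) hp.le
      rw [show 1 + (m - 1) = m by ring, e2] at this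
      have h1m : 1 - m ≤ 3 * q := by rw [hmdef]; nlinarith only [hδQ, hqQ, hq0]
      nlinarith only [h1m, this, hp1]
    have hbern2 : (1 - μ) * m ≤ 3 * (p - 1) / s * (q * (1 - q)) := by
      refine hbern.trans ?_
      rw [div_mul_eq_mul_div, le_div_iff₀ hspos]
      have : 0 ≤ 3 * (p - 1) * q * (1 - q - s) := by
        have : 0 ≤ 1 - q - s := by linarith
        positivity
      linarith
    have h8 : 8 * zr * ((1 - q) * (Q * r)) * (1 + r ^ 2) ≤ z * (4 * C3 * (1 + R2 ^ 2)) * (q * (1 - q)) := by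
      by_cases hR : R2 ≤ r
      · have hz0 := hzr0 hR
        have a1 : 0 ≤ (1 - q) * (Q * r) * (1 + r ^ 2) := by positivity
        have a2 : 0 ≤ z * (4 * C3 * (1 + R2 ^ 2)) * (q * (1 - q)) := by positivity
        have a3 : zr * ((1 - q) * (Q * r) * (1 + r ^ 2)) ≤ 0 := mul_nonpos_of_nonpos_of_nonneg hz0 a1
        linarith
      · push Not at hR
        have a1 : 0 ≤ 8 * ((1 - q) * (Q * r)) * (1 + r ^ 2) := by positivity
        have a2 := mul_le_mul_of_nonneg_left hzr a1
        have a3 : (Q * r) * (1 + r ^ 2) ≤ q / 2 * (1 + R2 ^ 2) :=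
          mul_le_mul hQr (by nlinarith only [hR, hr]) hrr.le (by positivity)
        have a4 : 0 ≤ 8 * (1 - q) * (C3 * z) := by positivity
        have a5 := mul_le_mul_of_nonneg_left a3 a4
        linarith
    have main3 := mul_le_mul_of_nonneg_right main hrr.le
    have k1 : (1 + κ * p) * ((1 - μ) * m) * N * z * (1 + r ^ 2) ≤
        3 * (p - 1) / s * (q * (1 - q)) * B * z := by
      have := mul_le_mul hbern2 hY2' (by positivity) (by positivity)
      linarith [mul_le_mul_of_nonneg_right this hz.le]
    have k2 : 2 * p * c * μ0 * c1 * (z * (q * (1 - q))) ≤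
        2 * p * c * N * μ * z * q * (1 - q) * (1 + r ^ 2) := by
      have : μ0 * c1 ≤ μ * (N * (1 + r ^ 2)) := mul_le_mul hμlow hY1 hc1.le hμnn
      have k : 0 ≤ 2 * p * c * (z * (q * (1 - q))) := by positivity
      linarith [mul_le_mul_of_nonneg_left this k]
    rw [hcc] at k2
    have k3 : z * (4 * n * Q * (1 - q)) * (1 + r ^ 2) = 4 * n * (z * (q * (1 - q))) := by
      rw [hq]; ring
    have k4 : 0 ≤ z * (8 * (Q * r) ^ 2) * (1 + r ^ 2) := by positivity
    have k5 : 0 < z * (q * (1 - q)) := by positivity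
    rw [hC4] at k2
    linarith

theorem aux_c2 {f : ℝ → ℝ} (hf : ContDiffOn ℝ 2 f (Set.Ioi 0)) :
    (∀ r > 0, HasDerivAt f (deriv f r) r) ∧
      ∀ r > 0, HasDerivAt (deriv f) (deriv (deriv f) r) r := by
  refine ⟨fun r hr => ((hf.differentiableOn (by norm_num) r hr).differentiableAt
    (Ioi_mem_nhds hr)).hasDerivAt, fun r hr => ?_⟩
  have h1 : ContDiffOn ℝ 1 (deriv f) (Set.Ioi 0) := by
    rw [← one_add_one_eq_two] at hf
    exact ((contDiffOn_succ_iff_deriv_of_isOpen (n := 1) isOpen_Ioi).1 hf).2.2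
  exact ((h1.differentiableOn (by norm_num) r hr).differentiableAt (Ioi_mem_nhds hr)).hasDerivAt

theorem aux_params (n : ℕ) (hn : 10 < n) (p : ℝ) (hp : pc n < p) :
    1 < p ∧ 0 < nuExp p ∧ nuExp p < ((n : ℝ) - 2) / 2 := by
  have hn' : (10 : ℝ) < n := by exact_mod_cast hn
  have h1 : ((n : ℝ) + 2) / (n - 2) < p := by
    refine lt_of_le_of_lt ?_ hp
    unfold pc
    rw [div_le_div_iff₀ (by linarith) (by nlinarith)]
    have hs := Real.sqrt_nonneg ((n : ℝ) - 1)
    have : ((n : ℝ) + 2) * (n - 10) ≤ ((n : ℝ) - 2) ^ 2 - 4 * n + 8 * Real.sqrt ((n : ℝ) - 1) := by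
      nlinarith
    have := mul_le_mul_of_nonneg_right this (show (0:ℝ) ≤ n - 2 by linarith)
    linarith
  rw [div_lt_iff₀ (by linarith)] at h1
  have hp1 : 1 < p := by nlinarith
  refine ⟨hp1, by unfold nuExp; apply div_pos <;> linarith, ?_⟩
  unfold nuExp
  rw [div_lt_div_iff₀ (by linarith) (by norm_num)]
  linarith

theorem aux_params2 (n : ℕ) (hn : 10 < n) (p γ : ℝ) (hp : pc n < p)
    (hγ : γ ∈ Set.Ioo (nuExp p + lam1 n p) (((n : ℝ) - 2) / 2)) :
    0 < lam1 n p ∧ 0 < Lconst n p ∧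
      p * Lconst n p ^ (p - 1) = (nuExp p + 2) * (n - 2 - nuExp p) ∧
      0 < p * Lconst n p ^ (p - 1) ∧
      0 < kappaOf n p γ ∧
      (1 + kappaOf n p γ) * (p * Lconst n p ^ (p - 1)) = γ * (n - 2 - γ) ∧
      nuExp p < γ ∧ (p - 1) * nuExp p = 2 := by
  obtain ⟨hp1, hν, hν2⟩ := aux_params n hn p hp
  obtain ⟨hγ1, hγ2⟩ := hγ
  have hn' : (10 : ℝ) < n := by exact_mod_cast hn
  have hpν : (p - 1) * nuExp p = 2 := by
    unfold nuExp; field_simp [show p - 1 ≠ 0 by linarith]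
  set ν := nuExp p with hνdef
  have hpos : 0 < ν * ((n : ℝ) - 2 - ν) := mul_pos hν (by linarith)
  have hL : 0 < Lconst n p := by unfold Lconst; positivity
  have hLp : Lconst n p ^ (p - 1) = ν * ((n : ℝ) - 2 - ν) := by
    unfold Lconst
    rw [← Real.rpow_mul hpos.le, one_div_mul_cancel (by linarith), Real.rpow_one]
  have hP : p * Lconst n p ^ (p - 1) = (ν + 2) * (n - 2 - ν) := by
    rw [hLp]
    have : p * ν = ν + 2 := by linarith
    rw [← mul_assoc, this]
  have hPpos : 0 < p * Lconst n p ^ (p - 1) := by rw [hP]; apply mul_pos <;> linarith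
  set D := ((n : ℝ) - 2 - 2 * ν) ^ 2 - 8 * ((n : ℝ) - 2 - ν) with hD
  have hl : lam1 n p = (((n : ℝ) - 2 - 2 * ν) - Real.sqrt D) / 2 := rfl
  have hsD : 0 < Real.sqrt D := by rw [hl] at hγ1; linarith
  have hDpos : 0 < D := Real.sqrt_pos.1 hsD
  have hsq := Real.sq_sqrt hDpos.le
  have hlam : 0 < lam1 n p := by
    rw [hl]
    have : Real.sqrt D < (n : ℝ) - 2 - 2 * ν := by
      rw [Real.sqrt_lt' (by linarith)]; linarith
    linarith
  have hG : p * Lconst n p ^ (p - 1) < γ * (n - 2 - γ) := by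
    rw [hP]
    have : (ν + 2) * (n - 2 - ν) = (ν + lam1 n p) * (n - 2 - (ν + lam1 n p)) := by
      rw [hl]; nlinarith
    rw [this]
    nlinarith
  refine ⟨hlam, hL, hP, hPpos, ?_, ?_, by linarith, hpν⟩
  · unfold kappaOf
    rw [sub_pos, lt_div_iff₀ hPpos]; linarith
  · unfold kappaOf
    field_simp
    ring

theorem aux_phi_low {n : ℕ} (hn : 10 < n) {p α a : ℝ} (hp : 1 < p) {φ : ℝ → ℝ} (hφ : IsSteadyStateA n p α φ a) :
    ∃ C, ∀ r ≥ (0:ℝ), α - C * r ^ 2 ≤ φ r := by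
  have hn' : (10 : ℝ) < n := by exact_mod_cast hn
  have hα : 0 < α := by have := hφ.pos 0 le_rfl; rwa [hφ.val0] at this
  have hle : ∀ r ≥ (0:ℝ), φ r ≤ α := fun r hr => by
    rw [← hφ.val0]; exact hφ.anti.antitoneOn (by simp) hr hr
  set C := α ^ p / (2 * n) with hC
  have hCpos : 0 < C := by positivity
  set h : ℝ → ℝ := fun r => φ r + C * r ^ 2 with hh
  obtain ⟨hd1, hd2⟩ := aux_c2 hφ.smooth
  have hh1 : ∀ r > 0, HasDerivAt h (deriv φ r + C * (2 * r)) r := fun r hr => by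
    have := (hd1 r hr).add (((hasDerivAt_id r).pow 2).const_mul C)
    refine HasDerivAt.congr_deriv this ?_
    simp
  set G : ℝ → ℝ := fun r => r ^ (n - 1) * (deriv φ r + C * (2 * r)) with hG
  have hGd : ∀ r > 0, ∃ d ≥ 0, HasDerivAt G d r := fun r hr => by
    have e := (((hasDerivAt_id r).pow (n - 1)).mul
      ((hd2 r hr).add (((hasDerivAt_id r).const_mul 2).const_mul C)))
    refine ⟨_, ?_, e⟩
    have hode := hφ.ode r hr
    have h3 : φ r ^ p ≤ α ^ p := Real.rpow_le_rpow (hφ.pos r hr.le).le (hle r hr.le) (by linarith)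
    have h4 : α ^ p = 2 * n * C := by rw [hC]; field_simp
    obtain ⟨k, hk⟩ : ∃ k, n = k + 2 := ⟨n - 2, by omega⟩
    subst hk
    have e1 : k + 2 - 1 = k + 1 := by omega
    simp only [id, e1, Nat.add_sub_cancel, mul_one, Pi.add_apply, Pi.pow_apply]
    push_cast at *
    have h5 : deriv (deriv φ) r = - (((k:ℝ) + 1) / r * deriv φ r) - φ r ^ p := by
      have : (k:ℝ) + 2 - 1 = k + 1 := by ring
      rw [this] at hode; linarith
    rw [h5]
    have : ((k:ℝ) + 1) * r ^ k * (deriv φ r + C * (2 * r)) + r ^ (k + 1) *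
        (-(((k:ℝ) + 1) / r * deriv φ r) - φ r ^ p + C * 2) = r ^ (k+1) * (2 * (k + 2) * C - φ r ^ p) := by
      field_simp; ring
    rw [this]
    apply mul_nonneg (by positivity); linarith
  have hGmono : MonotoneOn G (Set.Ioi 0) := by
    apply monotoneOn_of_deriv_nonneg (convex_Ioi 0)
    · intro r hr; obtain ⟨d, _, hd⟩ := hGd r hr; exact hd.continuousAt.continuousWithinAt
    · intro r hr; rw [interior_Ioi] at hr; obtain ⟨d, _, hd⟩ := hGd r hr
      exact hd.differentiableAt.differentiableWithinAt
    · intro r hr; rw [interior_Ioi] at hr; obtain ⟨d, h0, hd⟩ := hGd r hr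
      rw [hd.deriv]; exact h0
  have hG0 : ∀ r > 0, 0 ≤ G r := by
    intro r hr
    by_contra hneg
    push Not at hneg
    set r0 := min r 1 with hr0
    have hr0pos : 0 < r0 := by positivity
    have hr01 : r0 ≤ 1 := min_le_right _ _
    set e := - G r0 with he
    have hepos : 0 < e := by
      have := hGmono hr0pos hr (min_le_left _ _)
      linarith
    -- h + e log antitone on Ioc 0 r0
    have hanti : AntitoneOn (fun s => h s + e * Real.log s) (Set.Ioc 0 r0) := by
      have hder : ∀ s ∈ Set.Ioc (0:ℝ) r0, HasDerivAt (fun s => h s + e * Real.log s)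
          ((deriv φ s + C * (2 * s)) + e * s⁻¹) s := fun s hs =>
        (hh1 s hs.1).add ((Real.hasDerivAt_log hs.1.ne').const_mul e)
      apply antitoneOn_of_deriv_nonpos (convex_Ioc 0 r0)
      · intro s hs; exact (hder s hs).continuousAt.continuousWithinAt
      · intro s hs; exact (hder s (interior_subset hs)).differentiableAt.differentiableWithinAt
      · intro s hs
        have hs' := interior_subset hs
        rw [(hder s hs').deriv]
        have h1 : G s ≤ -e := by
          have := hGmono hs'.1 hr0pos hs'.2; linarith
        have hs0 := hs'.1
        have hpow : s ^ (n - 1) ≤ s := by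
          calc s ^ (n - 1) ≤ s ^ 1 := pow_le_pow_of_le_one hs0.le (hs'.2.trans hr01) (by omega)
            _ = s := pow_one s
        have hpp : 0 < s ^ (n - 1) := by positivity
        have hX : (deriv φ s + C * (2 * s)) < 0 := by
          by_contra hx; push Not at hx
          have : 0 ≤ G s := mul_nonneg hpp.le hx
          linarith
        have h2 : s * (deriv φ s + C * (2 * s)) ≤ -e := by
          have : s * (deriv φ s + C * (2 * s)) ≤ s ^ (n-1) * (deriv φ s + C * (2 * s)) :=
            mul_le_mul_of_nonpos_right hpow hX.le
          exact this.trans h1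
        have h3 : (deriv φ s + C * (2 * s)) + e * s⁻¹ = (s * (deriv φ s + C * (2 * s)) + e) * s⁻¹ := by
          field_simp
        rw [h3]
        exact mul_nonpos_of_nonpos_of_nonneg (by linarith) (by positivity)
    have hb : ∀ s ∈ Set.Ioc (0:ℝ) r0, h r0 + e * Real.log r0 - (α + C) ≤ e * Real.log s := by
      intro s hs
      have h1 : h r0 + e * Real.log r0 ≤ h s + e * Real.log s := hanti hs (by simp [hr0pos]) hs.2
      have h2 : h s ≤ α + C := by
        have := hle s hs.1.le
        have h3 : s ^ 2 ≤ 1 := pow_le_one₀ hs.1.le (hs.2.trans hr01)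
        simp only [hh]; nlinarith
      linarith
    have ht := Real.tendsto_log_nhdsGT_zero.const_mul_atBot hepos
    have hev := ht.eventually (eventually_lt_atBot (h r0 + e * Real.log r0 - (α + C)))
    have hev2 : ∀ᶠ s in nhdsWithin (0:ℝ) (Set.Ioi 0), s ∈ Set.Ioc 0 r0 :=
      Ioc_mem_nhdsGT hr0pos
    obtain ⟨s, hs1, hs2⟩ := (hev.and hev2).exists
    linarith [hb s hs2]
  have hcont : ContinuousOn h (Set.Ici 0) := hφ.cont.add (by fun_prop)
  have hmono : MonotoneOn h (Set.Ici 0) := by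
    apply monotoneOn_of_deriv_nonneg (convex_Ici 0) hcont
    · intro r hr; rw [interior_Ici] at hr; exact (hh1 r hr).differentiableAt.differentiableWithinAt
    · intro r hr; rw [interior_Ici] at hr
      rw [(hh1 r hr).deriv]
      have hr' : 0 < r := hr
      exact nonneg_of_mul_nonneg_right (hG0 r hr) (by positivity)
  refine ⟨C, fun r hr => ?_⟩
  have := hmono (by simp) hr hr
  simp only [hh, hφ.val0] at this
  linarith

theorem aux_phi_asym {n : ℕ} {p α a : ℝ} (hp : 1 < p) (hL : 0 < Lconst n p)
    (hl : 0 < lam1 n p) (hpν : (p - 1) * nuExp p = 2)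
    {φ : ℝ → ℝ} (hφ : IsSteadyStateA n p α φ a) :
    ∃ B > 0, ∃ R ≥ 1, ∀ r ≥ R, Lconst n p ^ (p - 1) * r ^ (-2:ℝ) * (1 - B * r ^ (- lam1 n p))
      ≤ φ r ^ (p - 1) := by
  set L := Lconst n p
  set ν := nuExp p
  set l := lam1 n p
  have ha := hφ.a_pos
  have h1 := hφ.expansion.bound ha
  obtain ⟨R1, hR1⟩ := eventually_atTop.1 h1
  have h2 : Tendsto (fun r : ℝ => (2 * a / L) * r ^ (-l)) atTop (nhds ((2 * a / L) * 0)) :=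
    (tendsto_rpow_neg_atTop hl).const_mul _
  rw [mul_zero] at h2
  obtain ⟨R2, hR2⟩ := eventually_atTop.1 (h2.eventually (eventually_le_nhds (show (0:ℝ) < 1 by norm_num)))
  set k := max 1 (p - 1) with hk
  have hk1 : 1 ≤ k := le_max_left _ _
  refine ⟨k * (2 * a / L), by positivity, max 1 (max R1 R2), le_max_left _ _, fun r hr => ?_⟩
  have hr1 : 1 ≤ r := (le_max_left _ _).trans hr
  have hr2 : R1 ≤ r := ((le_max_left _ _).trans (le_max_right _ _)).trans hr
  have hr3 : R2 ≤ r := ((le_max_right _ _).trans (le_max_right _ _)).trans hr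
  have hr0 : 0 < r := by linarith
  have b1 := hR1 r hr2
  have b2 := hR2 r hr3
  set x := (2 * a / L) * r ^ (-l) with hx
  have hx0 : 0 ≤ x := by positivity
  rw [Real.norm_eq_abs, Real.norm_of_nonneg (by positivity)] at b1
  have b3 := (abs_le.1 b1).1
  have hsplit : r ^ (-ν - l) = r ^ (-ν) * r ^ (-l) := by
    rw [← Real.rpow_add hr0]; congr 1
  have hlow : L * r ^ (-ν) * (1 - x) ≤ φ r := by
    have : L * r ^ (-ν) * x = 2 * a * (r ^ (-ν) * r ^ (-l)) := by
      rw [hx]; field_simp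
    rw [hsplit] at b3
    linarith
  have hpw : (L * r ^ (-ν) * (1 - x)) ^ (p - 1) ≤ φ r ^ (p - 1) :=
    Real.rpow_le_rpow (by have : 0 ≤ 1 - x := by linarith
                          positivity) hlow (by linarith)
  rw [Real.mul_rpow (by positivity) (by linarith), Real.mul_rpow hL.le (by positivity),
    ← Real.rpow_mul hr0.le, show -ν * (p - 1) = -2 by linarith] at hpw
  refine le_trans ?_ hpw
  apply mul_le_mul_of_nonneg_left _ (by positivity)
  rw [mul_assoc, ← hx]
  rcases le_total 1 (p - 1) with h | h
  · have := one_add_mul_self_le_rpow_one_add (s := -x) (by linarith) h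
    rw [hk, max_eq_right h]
    rw [show 1 + -x = 1 - x by ring] at this
    linarith
  · rw [hk, max_eq_left h]
    have := Real.rpow_le_rpow_of_exponent_ge' (x := 1 - x) (by linarith) (by linarith) (by linarith : 0 ≤ p - 1) h
    rw [Real.rpow_one] at this
    linarith

theorem aux_phi_c1 {n : ℕ} {p α a : ℝ} (hp : 1 < p) (hL : 0 < Lconst n p)
    (hl : 0 < lam1 n p) (hpν : (p - 1) * nuExp p = 2)
    {φ : ℝ → ℝ} (hφ : IsSteadyStateA n p α φ a) :
    ∃ c > 0, ∀ r ≥ 0, c ≤ φ r ^ (p - 1) * (1 + r ^ 2) := by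
  obtain ⟨B, hB, R, hR, h⟩ := aux_phi_asym hp hL hl hpν hφ
  have h2 : Tendsto (fun r : ℝ => B * r ^ (-lam1 n p)) atTop (nhds (B * 0)) :=
    (tendsto_rpow_neg_atTop hl).const_mul _
  rw [mul_zero] at h2
  obtain ⟨R2, hR2⟩ := eventually_atTop.1 (h2.eventually (eventually_le_nhds (show (0:ℝ) < 1/2 by norm_num)))
  set R3 := max R R2
  have hR3 : 0 < R3 := lt_of_lt_of_le (by linarith) (le_max_left R R2)
  have hpos := hφ.pos R3 hR3.le
  refine ⟨min (φ R3 ^ (p - 1)) (Lconst n p ^ (p - 1) / 2), by positivity, fun r hr => ?_⟩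
  rcases le_total r R3 with hc | hc
  · refine (min_le_left _ _).trans ?_
    have h1 : φ R3 ^ (p - 1) ≤ φ r ^ (p - 1) := Real.rpow_le_rpow hpos.le
      (hφ.anti.antitoneOn hr hR3.le hc) (by linarith)
    have h0 : 0 ≤ φ R3 ^ (p - 1) := by positivity
    nlinarith [mul_nonneg (h0.trans h1) (sq_nonneg r)]
  · refine (min_le_right _ _).trans ?_
    have hr0 : 0 < r := by linarith
    have h1 := h r ((le_max_left _ _).trans hc)
    have h3 := hR2 r ((le_max_right _ _).trans hc)
    have h4 : Lconst n p ^ (p - 1) * r ^ (-2:ℝ) * (1 / 2) ≤ φ r ^ (p - 1) := by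
      refine le_trans ?_ h1
      apply mul_le_mul_of_nonneg_left (by linarith) (by positivity)
    have h5 : r ^ (-2:ℝ) * r ^ 2 = 1 := by
      rw [← Real.rpow_natCast, ← Real.rpow_add hr0]; norm_num
    have h6 : 0 ≤ φ r ^ (p - 1) := by have := hφ.pos r hr; positivity
    have h7 := mul_le_mul_of_nonneg_right h4 (sq_nonneg r)
    have h8 : Lconst n p ^ (p - 1) * r ^ (-2:ℝ) * (1 / 2) * r ^ 2 = Lconst n p ^ (p - 1) / 2 := by
      linear_combination Lconst n p ^ (p - 1) / 2 * h5
    linarith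

theorem aux_phi_upper {n : ℕ} {p α a : ℝ} (hν : 0 < nuExp p) (hL : 0 < Lconst n p)
    {φ : ℝ → ℝ} (hφ : IsSteadyStateA n p α φ a) :
    ∃ C > 0, ∀ r ≥ 0, φ r ≤ C * (1 + r) ^ (- nuExp p) := by
  set ν := nuExp p
  have hα : 0 < α := by have := hφ.pos 0 le_rfl; rwa [hφ.val0] at this
  refine ⟨2 ^ ν * (α + Lconst n p), by positivity, fun r hr => ?_⟩
  rcases le_total r 1 with h | h
  · have h1 : φ r ≤ α := by
      rw [← hφ.val0]; exact hφ.anti.antitoneOn (by simp) hr hr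
    have h2 : (2:ℝ) ^ (-ν) ≤ (1 + r) ^ (-ν) :=
      Real.rpow_le_rpow_of_nonpos (by linarith) (by linarith) (by linarith)
    have h3 : (2:ℝ) ^ ν * 2 ^ (-ν) = 1 := by
      rw [← Real.rpow_add (by norm_num)]; simp
    calc φ r ≤ (α + Lconst n p) * 1 := by linarith
      _ = 2 ^ ν * (α + Lconst n p) * 2 ^ (-ν) := by rw [← h3]; ring
      _ ≤ _ := mul_le_mul_of_nonneg_left h2 (by positivity)
  · have h1 := hφ.upper r (by linarith)
    have h2 : (2 * r) ^ (-ν) ≤ (1 + r) ^ (-ν) :=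
      Real.rpow_le_rpow_of_nonpos (by linarith) (by linarith) (by linarith)
    rw [Real.mul_rpow (by norm_num) hr] at h2
    have h3 : (2:ℝ) ^ ν * 2 ^ (-ν) = 1 := by
      rw [← Real.rpow_add (by norm_num)]; simp
    have h4 : 0 ≤ r ^ (-ν) := by positivity
    calc φ r ≤ Lconst n p * r ^ (-ν) := h1
      _ ≤ (α + Lconst n p) * r ^ (-ν) * 1 := by nlinarith
      _ = 2 ^ ν * (α + Lconst n p) * (2 ^ (-ν) * r ^ (-ν)) := by rw [← h3]; ring
      _ ≤ _ := mul_le_mul_of_nonneg_left h2 (by positivity)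

set_option maxHeartbeats 2000000 in
theorem aux_psi (n γ l B R b : ℝ) (hγ0 : 0 < γ) (hγ : γ < (n - 2) / 2) (hl : 0 < l)
    (hB : 0 < B) (hR : 1 ≤ R) (hb : 0 < b) (Φ : ℝ → ℝ) (hΦ0 : ∀ r > 0, 0 ≤ Φ r)
    (hΦ : ∀ r ≥ R, γ * (n - 2 - γ) * r ^ (-2:ℝ) * (1 - B * r ^ (-l)) ≤ Φ r) :
    ∃ ψ : ℝ → ℝ, Continuous ψ ∧ (∀ r ≥ 0, 0 < ψ r) ∧ (∀ r ≥ 0, ψ r ≤ b * (r + 1) ^ (-γ)) ∧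
      (∃ e > 0, ψ 0 = e ∧ ∀ᶠ s in nhdsWithin 0 (Set.Ioi 0), e * (1 + s) ≤ ψ s) ∧
      ∃ C3 ≥ 0, ∃ R2 ≥ 1, ∀ r > 0, ∃ (χ χ1 : ℝ → ℝ) (d2 : ℝ),
        (∀ᶠ s in nhds r, χ s ≤ ψ s) ∧ χ r = ψ r ∧
        (∀ᶠ s in nhds r, HasDerivAt χ (χ1 s) s) ∧ HasDerivAt χ1 d2 r ∧
        0 ≤ d2 + (n - 1) / r * χ1 r + Φ r * ψ r ∧ χ1 r ≤ C3 * ψ r ∧ (R2 ≤ r → χ1 r ≤ 0) := by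
  set σ := min l ((n - 2 - 2 * γ) / 2) with hσ
  have hσpos : 0 < σ := lt_min hl (by linarith)
  have hσl : σ ≤ l := min_le_left _ _
  have hσ2 : σ ≤ (n - 2 - 2 * γ) / 2 := min_le_right _ _
  set d := σ * (n - 2 - 2 * γ - σ) with hd
  have hdpos : 0 < d := mul_pos hσpos (by linarith)
  set Γ := γ * (n - 2 - γ) with hΓ
  have hΓpos : 0 < Γ := mul_pos hγ0 (by linarith)
  set A := max (Γ * B / d) (R ^ σ) with hA
  have hA1 : Γ * B ≤ A * d := by
    rw [← div_le_iff₀ hdpos]; exact le_max_left _ _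
  have hAR : R ^ σ ≤ A := le_max_right _ _
  have hA0 : 1 ≤ A := (Real.one_le_rpow hR hσpos.le).trans hAR
  set M := A * max 2 ((γ + σ) / γ) with hM
  have hM2 : 2 * A ≤ M := by
    rw [hM, mul_comm]; exact mul_le_mul_of_nonneg_left (le_max_left _ _) (by linarith)
  have hM3 : A * (γ + σ) ≤ M * γ := by
    have : (γ + σ) / γ ≤ max 2 ((γ + σ) / γ) := le_max_right _ _
    rw [div_le_iff₀ hγ0] at this
    rw [hM, mul_assoc]; exact mul_le_mul_of_nonneg_left this (by linarith)
  have hM0 : 1 ≤ M := by linarith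
  set S := M ^ (1 / σ) with hS
  have hS1 : 1 ≤ S := Real.one_le_rpow hM0 (by positivity)
  have hSσ : S ^ σ = M := by
    rw [hS, ← Real.rpow_mul (by linarith), one_div_mul_cancel hσpos.ne', Real.rpow_one]
  -- y bound
  have hyS : ∀ r ≥ S, M * r ^ (-σ) ≤ 1 := fun r hr => by
    have hr0 : 0 < r := by linarith
    rw [Real.rpow_neg hr0.le, ← div_eq_mul_inv, div_le_one (by positivity), ← hSσ]
    exact Real.rpow_le_rpow (by linarith) hr hσpos.le
  set out : ℝ → ℝ := fun s => s ^ (-γ) - A * s ^ (-γ - σ) with hout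
  have hout' : ∀ s > 0, out s = s ^ (-γ) * (1 - A * s ^ (-σ)) := fun s hs => by
    simp only [hout]
    rw [show -γ - σ = -γ + -σ by ring, Real.rpow_add hs]; ring
  have hout1 : out 1 ≤ 0 := by simp [hout]; exact hA0
  have houtS : ∀ s ≥ S, s ^ (-γ) / 2 ≤ out s := fun s hs => by
    have hs0 : 0 < s := by linarith
    rw [hout' s hs0]
    have h1 := hyS s hs
    have h2 : 0 < s ^ (-γ) := by positivity
    have h3 : 0 < s ^ (-σ) := by positivity
    have : 2 * A * s ^ (-σ) ≤ 1 := le_trans (mul_le_mul_of_nonneg_right hM2 h3.le) h1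
    nlinarith
  set e0 := (2 * S + 1) ^ (-γ) / (4 * (1 + S)) with he0
  have he0pos : 0 < e0 := by positivity
  have he0S : e0 * (1 + S) = (2 * S + 1) ^ (-γ) / 4 := by rw [he0]; field_simp
  set inn : ℝ → ℝ := fun s => e0 * (1 + S - |s - S|) with hinn
  have hinnS : ∀ s < S, inn s = e0 * (1 + s) := fun s hs => by
    simp only [hinn]; rw [abs_of_neg (by linarith)]; ring
  have hinn_le : ∀ s, inn s ≤ (2 * S + 1) ^ (-γ) / 4 := fun s => by
    rw [← he0S]; simp only [hinn]
    apply mul_le_mul_of_nonneg_left _ he0pos.le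
    linarith [abs_nonneg (s - S)]
  have hinn_out : ∀ s ≥ S, inn s < out s := fun s hs => by
    have hs0 : 0 < s := by linarith
    have h2 : 0 < s ^ (-γ) := by positivity
    have h1 := houtS s hs
    rcases le_total s (2 * S + 1) with h | h
    · have h3 : (2 * S + 1) ^ (-γ) ≤ s ^ (-γ) :=
        Real.rpow_le_rpow_of_nonpos hs0 h (by linarith)
      have := hinn_le s
      linarith
    · have : inn s ≤ 0 := by
        simp only [hinn]; rw [abs_of_nonneg (by linarith)]
        exact mul_nonpos_of_nonneg_of_nonpos he0pos.le (by linarith)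
      linarith
  set oh : ℝ → ℝ := fun s => out (max s 1) with hoh
  have hohcont : Continuous oh := by
    have h1 : ∀ c : ℝ, Continuous fun s : ℝ => (max s 1) ^ c := fun c =>
      (continuous_id.max continuous_const).rpow_const fun s => Or.inl (by
        have : (0:ℝ) < max s 1 := lt_of_lt_of_le one_pos (le_max_right _ _)
        exact this.ne')
    exact (h1 _).sub ((h1 _).const_mul A)
  set ψ0 : ℝ → ℝ := fun s => max (oh s) (inn s) with hψ0
  have hinncont : Continuous inn := by simp only [hinn]; fun_prop
  have hψ0cont : Continuous ψ0 := hohcont.max hinncont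
  have hlow : ∀ r ≥ 0, r < S → e0 ≤ ψ0 r := fun r hr hrS => by
    refine le_trans ?_ (le_max_right _ _)
    rw [hinnS r hrS]; nlinarith
  have hohS : ∀ r ≥ S, oh r = out r := fun r hr => by
    simp only [hoh]; rw [max_eq_left (by linarith)]
  have hψ0pos : ∀ r ≥ 0, 0 < ψ0 r := fun r hr => by
    rcases lt_or_ge r S with h | h
    · exact he0pos.trans_le (hlow r hr h)
    · refine lt_of_lt_of_le ?_ (le_max_left _ _)
      rw [hohS r h]
      have hr0 : 0 < r := by linarith
      have h2 : 0 < r ^ (-γ) := by positivity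
      linarith [houtS r h]
  set K := (2:ℝ) ^ γ with hK
  have hK1 : 1 ≤ K := Real.one_le_rpow (by norm_num) hγ0.le
  have hohup : ∀ r ≥ 0, oh r ≤ K * (r + 1) ^ (-γ) := fun r hr => by
    have hm : 0 < max r 1 := lt_of_lt_of_le one_pos (le_max_right _ _)
    have h1 : oh r ≤ (max r 1) ^ (-γ) := by
      simp only [hoh, hout]
      have : 0 < (max r 1) ^ (-γ - σ) := by positivity
      nlinarith
    have h2 : (2 * max r 1) ^ (-γ) ≤ (r + 1) ^ (-γ) :=
      Real.rpow_le_rpow_of_nonpos (by linarith)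
        (by linarith [le_max_left r 1, le_max_right r 1]) (by linarith)
    rw [Real.mul_rpow (by norm_num) hm.le] at h2
    have h3 : K * 2 ^ (-γ) = 1 := by
      rw [hK, ← Real.rpow_add (by norm_num)]; simp
    calc oh r ≤ (max r 1) ^ (-γ) := h1
      _ = K * (2 ^ (-γ) * (max r 1) ^ (-γ)) := by rw [← mul_assoc, h3, one_mul]
      _ ≤ _ := mul_le_mul_of_nonneg_left h2 (by linarith)
  have hψ0up : ∀ r ≥ 0, ψ0 r ≤ K * (r + 1) ^ (-γ) := fun r hr => by
    refine max_le (hohup r hr) ?_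
    rcases lt_or_ge r S with h | h
    · have h1 : (2 * S + 1) ^ (-γ) ≤ (r + 1) ^ (-γ) :=
        Real.rpow_le_rpow_of_nonpos (by linarith) (by linarith) (by linarith)
      have h2 : 0 < (2 * S + 1) ^ (-γ) := by positivity
      have := hinn_le r
      nlinarith
    · have := hinn_out r h
      have h2 := hohup r hr
      rw [hohS r h] at h2
      linarith
  set ε := b / K with hε
  have hεpos : 0 < ε := by positivity
  have hεK : ε * K = b := by rw [hε]; field_simp
  refine ⟨fun s => ε * ψ0 s, continuous_const.mul hψ0cont, fun r hr => mul_pos hεpos (hψ0pos r hr),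
    fun r hr => ?_, ⟨ε * e0, by positivity, ?_, ?_⟩, 1 + A * (γ + σ) / e0, by positivity, S, hS1, ?_⟩
  · rw [← hεK, mul_assoc]; exact mul_le_mul_of_nonneg_left (hψ0up r hr) hεpos.le
  · have h1 : inn 0 = e0 := by rw [hinnS 0 (by linarith)]; ring
    have h2 : ψ0 0 = e0 := by
      simp only [hψ0, h1]
      apply max_eq_right
      simp only [hoh]
      rw [max_eq_right (by norm_num)]; linarith
    simp only [h2]
  · have : ∀ᶠ s in nhdsWithin (0:ℝ) (Set.Ioi 0), s < S :=
      nhdsWithin_le_nhds (Iio_mem_nhds (by linarith))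
    filter_upwards [this] with s hs
    rw [mul_assoc]; apply mul_le_mul_of_nonneg_left _ hεpos.le
    rw [← hinnS s hs]; exact le_max_right _ _
  · intro r hr
    rcases le_or_gt (inn r) (oh r) with hcase | hcase
    · -- out active
      have hact : ψ0 r = oh r := max_eq_left hcase
      have hpos := hψ0pos r hr.le
      have hr1 : 1 < r := by
        by_contra hlt
        push Not at hlt
        have : oh r = out 1 := by simp only [hoh]; rw [max_eq_right hlt]
        linarith
      have hactr : ψ0 r = out r := by rw [hact]; simp only [hoh]; rw [max_eq_left hr1.le]
      have hev1 : ∀ᶠ s in nhds r, 1 < s := Ioi_mem_nhds hr1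
      refine ⟨fun s => ε * out s, fun s => ε * (-γ * s ^ (-γ - 1) - A * ((-γ - σ) * s ^ (-γ - σ - 1))),
        ε * (-γ * ((-γ - 1) * r ^ (-γ - 1 - 1)) - A * ((-γ - σ) * ((-γ - σ - 1) * r ^ (-γ - σ - 1 - 1)))),
        ?_, by simp only [hactr], ?_, ?_, ?_, ?_, ?_⟩
      · filter_upwards [hev1] with s hs
        apply mul_le_mul_of_nonneg_left _ hεpos.le
        have : out s = oh s := by simp only [hoh]; rw [max_eq_left hs.le]
        rw [this]; exact le_max_left _ _
      · filter_upwards [hev1] with s hs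
        have hs0 : s ≠ 0 := by linarith
        exact (((Real.hasDerivAt_rpow_const (Or.inl hs0)).sub
          ((Real.hasDerivAt_rpow_const (Or.inl hs0)).const_mul A)).const_mul ε)
      · exact ((((Real.hasDerivAt_rpow_const (Or.inl hr.ne')).const_mul (-γ)).sub
          (((Real.hasDerivAt_rpow_const (Or.inl hr.ne')).const_mul (-γ - σ)).const_mul A)).const_mul ε)
      · -- pde
        set y := r ^ (-σ) with hy
        set u := r ^ (-γ - 2) with hu
        have hypos : 0 < y := by positivity
        have hupos : 0 < u := by positivity
        have f1 : r ^ (-γ - 1) = u * r := by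
          rw [hu, ← Real.rpow_add_one hr.ne']; congr 1; ring
        have f2 : r ^ (-γ - 1 - 1) = u := by rw [hu]; congr 1; ring
        have f3 : r ^ (-γ - σ - 1) = u * y * r := by
          rw [hu, hy, ← Real.rpow_add hr, ← Real.rpow_add_one hr.ne']; congr 1; ring
        have f4 : r ^ (-γ - σ - 1 - 1) = u * y := by
          rw [hu, hy, ← Real.rpow_add hr]; congr 1; ring
        have f5 : r ^ (-2:ℝ) * r ^ (-γ) = u := by
          rw [hu, ← Real.rpow_add hr]; congr 1; ring
        have hAy : 0 < 1 - A * y := by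
          rw [hactr, hout' r hr] at hpos
          exact (pos_iff_pos_of_mul_pos hpos).1 (by positivity)
        have hRr : R ≤ r := by
          by_contra hlt
          push Not at hlt
          have h1 : r ^ σ ≤ A := (Real.rpow_le_rpow hr.le hlt.le hσpos.le).trans hAR
          have h2 : r ^ σ * y = 1 := by rw [hy, ← Real.rpow_add hr]; simp
          nlinarith
        have hly : r ^ (-l) ≤ y := Real.rpow_le_rpow_of_exponent_le hr1.le (by linarith)
        have h6 : Γ * r ^ (-2:ℝ) * (1 - B * y) ≤ Φ r := by
          refine le_trans ?_ (hΦ r hRr)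
          apply mul_le_mul_of_nonneg_left _ (by positivity)
          nlinarith
        have h7 := mul_le_mul_of_nonneg_right h6 hpos.le
        rw [hactr, hout' r hr, ← hy] at h7
        have h8 : Γ * r ^ (-2:ℝ) * (1 - B * y) * (r ^ (-γ) * (1 - A * y))
          = Γ * u * ((1 - B * y) * (1 - A * y)) := by rw [← f5]; ring
        rw [h8] at h7
        simp only [hactr, hout' r hr, ← hy, f1, f2, f3, f4]
        have h9 : ε * (-γ * ((-γ - 1) * u) - A * ((-γ - σ) * ((-γ - σ - 1) * (u * y)))) +
            (n - 1) / r * (ε * (-γ * (u * r) - A * ((-γ - σ) * (u * y * r))))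
            = ε * (u * (-Γ + A * y * (Γ + d))) := by
          rw [hΓ, hd]; field_simp; ring
        rw [h9]
        have h10 : 0 ≤ u * (-Γ + A * y * (Γ + d)) + Γ * u * ((1 - B * y) * (1 - A * y)) := by
          have e : u * (-Γ + A * y * (Γ + d)) + Γ * u * ((1 - B * y) * (1 - A * y))
            = u * y * (A * d - Γ * B) + Γ * u * A * B * y ^ 2 := by ring
          rw [e]
          have : 0 ≤ A * d - Γ * B := by linarith
          positivity
        have h11 : 0 ≤ ε * (u * (-Γ + A * y * (Γ + d)) + Φ r * (r ^ (-γ) * (1 - A * y))) :=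
          mul_nonneg hεpos.le (by linarith)
        linarith
      all_goals
        have hdle : S ≤ r → (-γ * r ^ (-γ - 1) - A * ((-γ - σ) * r ^ (-γ - σ - 1))) ≤ 0 := by
          intro hSr
          have h1 := hyS r hSr
          have f3 : r ^ (-γ - σ - 1) = r ^ (-γ - 1) * r ^ (-σ) := by
            rw [← Real.rpow_add hr]; congr 1; ring
          rw [f3]
          have h2 : 0 < r ^ (-γ - 1) := by positivity
          have h3 : 0 < r ^ (-σ) := by positivity
          have h4 : A * (γ + σ) * r ^ (-σ) ≤ M * γ * r ^ (-σ) := mul_le_mul_of_nonneg_right hM3 h3.le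
          have h5 : M * γ * r ^ (-σ) ≤ γ := by nlinarith
          have h6 : 0 ≤ r ^ (-γ - 1) * (γ - A * (γ + σ) * r ^ (-σ)) := mul_nonneg h2.le (by linarith)
          linarith
      · have : (-γ * r ^ (-γ - 1) - A * ((-γ - σ) * r ^ (-γ - σ - 1))) ≤ (1 + A * (γ + σ) / e0) * ψ0 r := by
          rcases lt_or_ge r S with h | h
          · have h1 := hlow r hr.le h
            have h2 : r ^ (-γ - σ - 1) ≤ 1 := Real.rpow_le_one_of_one_le_of_nonpos hr1.le (by linarith)
            have h3 : 0 < r ^ (-γ - 1) := by positivity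
            have h4 : A * (γ + σ) ≤ A * (γ + σ) / e0 * ψ0 r := by
              rw [div_mul_eq_mul_div, le_div_iff₀ he0pos]
              apply mul_le_mul_of_nonneg_left h1 (by positivity)
            have h5 : A * (γ + σ) * r ^ (-γ - σ - 1) ≤ A * (γ + σ) * 1 :=
              mul_le_mul_of_nonneg_left h2 (by positivity)
            nlinarith
          · refine (hdle h).trans ?_
            positivity
        have := mul_le_mul_of_nonneg_left this hεpos.le
        simp only
        linarith
      · intro h
        exact mul_nonpos_of_nonneg_of_nonpos hεpos.le (hdle h)
    · have hrS : r < S := by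
        by_contra h
        push Not at h
        have := hinn_out r h
        rw [hohS r h] at hcase
        linarith
      have hact : ψ0 r = inn r := max_eq_right hcase.le
      refine ⟨fun s => ε * (e0 * (1 + s)), fun _ => ε * e0, 0, ?_, ?_, ?_, hasDerivAt_const _ _, ?_, ?_, ?_⟩
      · filter_upwards [Iio_mem_nhds hrS] with s hs
        apply mul_le_mul_of_nonneg_left _ hεpos.le
        rw [← hinnS s hs]; exact le_max_right _ _
      · simp only [hact, hinnS r hrS]
      · refine Eventually.of_forall fun s => ?_
        have := (((hasDerivAt_id s).const_add 1).const_mul e0).const_mul ε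
        simpa using this
      · have h1 : 0 ≤ (n - 1) / r := div_nonneg (by linarith) hr.le
        have h2 := hΦ0 r hr
        have h3 := hψ0pos r hr.le
        positivity
      · have h1 := hlow r hr.le hrS
        have h2 : 0 ≤ A * (γ + σ) / e0 * ψ0 r := by have := hψ0pos r hr.le; positivity
        have := mul_le_mul_of_nonneg_left (show e0 ≤ (1 + A * (γ + σ) / e0) * ψ0 r by linarith) hεpos.le
        simp only
        linarith
      · intro h; linarith

theorem aux_convex {p φ w : ℝ} (hp : 1 < p) (hφ : 0 < φ) (hw : 0 ≤ w) :
    φ ^ p + p * φ ^ (p - 1) * w ≤ (φ + w) ^ p := by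
  have h := one_add_mul_self_le_rpow_one_add (s := w / φ)
    (by have : 0 ≤ w / φ := by positivity
        linarith) hp.le
  have h1 := mul_le_mul_of_nonneg_left h (show 0 ≤ φ ^ p by positivity)
  rw [← Real.mul_rpow hφ.le (by positivity)] at h1
  have e1 : φ * (1 + w / φ) = φ + w := by field_simp
  have e2 : φ ^ p = φ ^ (p - 1) * φ := by
    rw [← Real.rpow_add_one hφ.ne']; congr 1; ring
  rw [e1] at h1
  refine le_trans (le_of_eq ?_) h1
  rw [e2]; field_simp

/-- the barrier -/
def auxZ (φ ψ : ℝ → ℝ) (κ c δ r t : ℝ) : ℝ :=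
  (φ r + Real.exp (-κ * t) * ψ r) * ((1 - δ * Real.exp (c * t) * (1 + r ^ 2)) ^ 2 - δ)

/-- test functions from below -/
def auxTest (n : ℝ) (Φ ψ : ℝ → ℝ) (C3 R2 : ℝ) : Prop :=
  ∀ r > 0, ∃ (χ χ1 : ℝ → ℝ) (d2 : ℝ),
        (∀ᶠ s in nhds r, χ s ≤ ψ s) ∧ χ r = ψ r ∧
        (∀ᶠ s in nhds r, HasDerivAt χ (χ1 s) s) ∧ HasDerivAt χ1 d2 r ∧
        0 ≤ d2 + (n - 1) / r * χ1 r + Φ r * ψ r ∧ χ1 r ≤ C3 * ψ r ∧ (R2 ≤ r → χ1 r ≤ 0)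

theorem aux_touch0 {n : ℕ} (hn : 10 < n) {p α a κ : ℝ} (hp : 1 < p)
    {φ ψ : ℝ → ℝ} (hφ : IsSteadyStateA n p α φ a)
    {v : ℝ → ℝ → ℝ} {v₀ : ℝ → ℝ} (hv : IsRadialSol n p v v₀)
    {e0 c δ t : ℝ} (he0 : 0 < e0) (hψ0 : ψ 0 = e0)
    (hψe : ∀ᶠ s in nhdsWithin 0 (Set.Ioi 0), e0 * (1 + s) ≤ ψ s)
    (hδ : 0 < δ) (hδ4 : δ < 1 / 4) (hQ : δ * Real.exp (c * t) ≤ 1 / 2) (ht : 0 < t)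
    (heq : v 0 t = auxZ φ ψ κ c δ 0 t)
    (hsp : ∀ᶠ s in nhdsWithin 0 (Set.Ioi 0), auxZ φ ψ κ c δ s t ≤ v s t) : False := by
  obtain ⟨C, hC⟩ := aux_phi_low hn hp hφ
  set e := Real.exp (-κ * t) with he
  have hepos : 0 < e := Real.exp_pos _
  set Q := δ * Real.exp (c * t) with hQd
  have hQpos : 0 < Q := by positivity
  have hα : 0 < α := by have := hφ.pos 0 le_rfl; rwa [hφ.val0] at this
  set m : ℝ → ℝ := fun s => (1 - Q * (1 + s ^ 2)) ^ 2 - δ with hm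
  have hmd : HasDerivAt m 0 0 := by
    have := (((((hasDerivAt_id (0:ℝ)).pow 2).const_add 1).const_mul Q).const_sub 1).pow 2 |>.sub_const δ
    refine HasDerivAt.congr_deriv this ?_
    simp
  have hm0 : 0 < m 0 := by simp only [hm]; nlinarith
  have hmev : ∀ᶠ s in nhds (0:ℝ), 0 < m s := hmd.continuousAt.eventually (lt_mem_nhds hm0)
  have hk : HasDerivAt (fun s => α - C * s ^ 2 + e * (e0 * (1 + s))) (e * e0) 0 := by
    have h1 := ((((hasDerivAt_id (0:ℝ)).pow 2).const_mul C).const_sub α).add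
      ((((hasDerivAt_id (0:ℝ)).const_add 1).const_mul e0).const_mul e)
    refine HasDerivAt.congr_deriv h1 ?_
    simp
  have hkm := hk.mul hmd
  have hvd : HasDerivWithinAt (fun r => v r t) 0 (Set.Ici 0) 0 := by
    have := ((hv.smooth_r t ht).differentiableOn (by norm_num) 0 (by simp)).hasDerivWithinAt
    rwa [hv.slope0 t ht] at this
  have hg := hvd.sub hkm.hasDerivWithinAt
  have := aux_right_deriv hg ?_
  · have : 0 < e * e0 * m 0 := by positivity
    simp at *
    linarith
  · filter_upwards [hψe, hsp, nhdsWithin_le_nhds hmev, self_mem_nhdsWithin] with s h1 h2 h3 h4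
    have h4' : 0 < s := h4
    have h5 := hC s h4'.le
    have h6 : (α - C * s ^ 2 + e * (e0 * (1 + s))) * m s ≤ auxZ φ ψ κ c δ s t := by
      unfold auxZ
      apply mul_le_mul_of_nonneg_right _ h3.le
      have := mul_le_mul_of_nonneg_left h1 hepos.le
      linarith
    have h7 : v 0 t = (α - C * 0 ^ 2 + e * (e0 * (1 + 0))) * m 0 := by
      rw [heq]; unfold auxZ; rw [hφ.val0, hψ0]; simp only [hm, ← he, ← hQd]; ring
    simp only [Pi.sub_apply, Pi.mul_apply]
    linarith

set_option maxHeartbeats 2000000 in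
theorem aux_touch1 {n : ℕ} {p α a κ : ℝ} (hp : 1 < p) (hκ : 0 < κ)
    {φ ψ : ℝ → ℝ} (hφ : IsSteadyStateA n p α φ a)
    {v : ℝ → ℝ → ℝ} {v₀ : ℝ → ℝ} (hv : IsRadialSol n p v v₀)
    {c1 C2 C3 R2 c s₀ δ t r : ℝ} (hC3 : 0 ≤ C3)
    (hψpos : ∀ r ≥ 0, 0 < ψ r)
    (hY1 : ∀ r ≥ 0, c1 ≤ φ r ^ (p - 1) * (1 + r ^ 2))
    (hY2 : ∀ r ≥ 0, (φ r + ψ r) ^ (p - 1) * (1 + r ^ 2) ≤ C2)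
    (htest : auxTest n (fun r => (1 + κ) * p * φ r ^ (p - 1)) ψ C3 R2)
    (hgap : ∀ δ Q r z w Lap zr : ℝ, 0 < δ → δ ≤ s₀ → δ ≤ Q →
      Q * (1 + R2 ^ 2) ≤ 1 / 2 → 0 < r → 0 < w → w ≤ z →
      c1 ≤ z ^ (p - 1) * (1 + r ^ 2) → z ^ (p - 1) * (1 + r ^ 2) ≤ C2 →
      -z ^ p - κ * p * z ^ (p - 1) * w ≤ Lap → zr ≤ C3 * z → (R2 ≤ r → zr ≤ 0) →
      Q * (1 + r ^ 2) < 1 → 0 ≤ (1 - Q * (1 + r ^ 2)) ^ 2 - δ →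
      Lap * ((1 - Q * (1 + r ^ 2)) ^ 2 - δ) + 2 * zr * (-(4 * (1 - Q * (1 + r ^ 2)) * (Q * r)))
        + z * (8 * (Q * r) ^ 2 - 4 * n * Q * (1 - Q * (1 + r ^ 2)))
        + (z * ((1 - Q * (1 + r ^ 2)) ^ 2 - δ)) ^ p ≤
        p * (z * ((1 - Q * (1 + r ^ 2)) ^ 2 - δ)) ^ (p - 1) *
          (-κ * w * ((1 - Q * (1 + r ^ 2)) ^ 2 - δ)
            + z * (-(2 * (1 - Q * (1 + r ^ 2)) * (c * (Q * (1 + r ^ 2)))))) → False)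
    (hδ : 0 < δ) (hδs : δ ≤ s₀) (hc : 0 < c)
    (hQ : δ * Real.exp (c * t) * (1 + R2 ^ 2) ≤ 1 / 2) (ht : 0 < t) (hr : 0 < r)
    (hq : δ * Real.exp (c * t) * (1 + r ^ 2) < 1)
    (heq : v r t = auxZ φ ψ κ c δ r t)
    (hsp : ∀ᶠ s in nhds r, auxZ φ ψ κ c δ s t ≤ v s t)
    (htm : ∀ᶠ s in nhdsWithin t (Set.Iio t), auxZ φ ψ κ c δ r s ≤ v r s) : False := by
  obtain ⟨hd1, hd2⟩ := aux_c2 hφ.smooth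
  obtain ⟨hv1, hv2⟩ := aux_c2 ((hv.smooth_r t ht).mono Set.Ioi_subset_Ici_self)
  obtain ⟨χ, χ1, d2, t1, t2, t3, t4, t5, t6, t7⟩ := htest r hr
  set e := Real.exp (-κ * t) with he
  have hepos : 0 < e := Real.exp_pos _
  have he1 : e ≤ 1 := by rw [he, Real.exp_le_one_iff]; nlinarith only [hκ, ht, mul_pos hκ ht]
  set Q := δ * Real.exp (c * t) with hQd
  have hQpos : 0 < Q := by positivity
  have hφr := hφ.pos r hr.le
  have hψr := hψpos r hr.le
  set z := φ r + e * ψ r with hz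
  have hwpos : 0 < e * ψ r := by positivity
  have hzpos : 0 < z := by positivity
  set m : ℝ → ℝ := fun s => (1 - Q * (1 + s ^ 2)) ^ 2 - δ with hm
  set m1 : ℝ → ℝ := fun s => -(4 * (1 - Q * (1 + s ^ 2)) * (Q * s)) with hm1
  have hmd : ∀ s, HasDerivAt m (m1 s) s := fun s => by
    have := (((((hasDerivAt_id s).pow 2).const_add 1).const_mul Q).const_sub 1).pow 2 |>.sub_const δ
    refine HasDerivAt.congr_deriv this ?_
    simp [hm1]; ring
  have hmd2 : HasDerivAt m1 (8 * (Q * r) ^ 2 - 4 * Q * (1 - Q * (1 + r ^ 2))) r := by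
    have := ((((((hasDerivAt_id r).pow 2).const_add 1).const_mul Q).const_sub 1).const_mul 4).mul
      ((hasDerivAt_id r).const_mul Q) |>.neg
    refine HasDerivAt.congr_deriv this ?_
    simp; ring
  have hZ : auxZ φ ψ κ c δ r t = z * m r := rfl
  have hvr := hv.nonneg r hr.le t ht.le
  have hmr : 0 ≤ m r := by
    rw [heq, hZ] at hvr
    exact nonneg_of_mul_nonneg_right hvr hzpos
  -- spatial
  have hpos_ev : ∀ᶠ s in nhds r, 0 < φ s + e * χ s := by
    have hcont : ContinuousAt (fun s => φ s + e * χ s) r :=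
      (hd1 r hr).continuousAt.add (t3.self_of_nhds.continuousAt.const_mul e)
    apply hcont.eventually (lt_mem_nhds _)
    simp only [t2]; exact hzpos
  have hr_ev : ∀ᶠ s in nhds r, 0 < s := Ioi_mem_nhds hr
  have hmin : IsLocalMin (fun s => v s t - (φ s + e * χ s) * m s) r := by
    have h0 : v r t - (φ r + e * χ r) * m r = 0 := by rw [t2, heq, hZ]; ring
    change ∀ᶠ s in nhds r, v r t - (φ r + e * χ r) * m r ≤ v s t - (φ s + e * χ s) * m s
    filter_upwards [hpos_ev, hr_ev, hsp, t1] with s h1 h2 h3 h4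
    rw [h0, sub_nonneg]
    rcases le_total 0 (m s) with hms | hms
    · refine le_trans ?_ h3
      unfold auxZ
      apply mul_le_mul_of_nonneg_right _ hms
      have := mul_le_mul_of_nonneg_left h4 hepos.le
      linarith
    · have h5 := hv.nonneg s h2.le t ht.le
      have := mul_nonpos_of_nonneg_of_nonpos h1.le hms
      linarith
  have hder : ∀ᶠ s in nhds r, HasDerivAt (fun s => v s t - (φ s + e * χ s) * m s)
      (deriv (fun ρ => v ρ t) s - ((deriv φ s + e * χ1 s) * m s + (φ s + e * χ s) * m1 s)) s := by
    filter_upwards [hr_ev, t3] with s h1 h2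
    exact (hv1 s h1).sub (((hd1 s h1).add (h2.const_mul e)).mul (hmd s))
  have hder2 : HasDerivAt (fun s => deriv (fun ρ => v ρ t) s -
      ((deriv φ s + e * χ1 s) * m s + (φ s + e * χ s) * m1 s))
      (deriv (deriv fun ρ => v ρ t) r - (((deriv (deriv φ) r + e * d2) * m r +
        (deriv φ r + e * χ1 r) * m1 r) + ((deriv φ r + e * χ1 r) * m1 r +
        (φ r + e * χ r) * (8 * (Q * r) ^ 2 - 4 * Q * (1 - Q * (1 + r ^ 2)))))) r :=
    (hv2 r hr).sub ((((hd2 r hr).add (t4.const_mul e)).mul (hmd r)).add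
      (((hd1 r hr).add (t3.self_of_nhds.const_mul e)).mul hmd2))
  obtain ⟨s1, s2⟩ := aux_second_deriv hder hder2 hmin
  rw [t2, ← hz] at s1 s2
  -- time
  have hvt : HasDerivAt (fun s => v r s ^ p) (deriv (fun s => v r s ^ p) t) t :=
    (((hv.smooth_t r hr.le).differentiableOn (by norm_num) t ht).differentiableAt
      (Ioi_mem_nhds ht)).hasDerivAt
  have hzt : HasDerivAt (fun s => auxZ φ ψ κ c δ r s)
      (-κ * (e * ψ r) * m r + z * (-(2 * (1 - Q * (1 + r ^ 2)) * (c * (Q * (1 + r ^ 2)))))) t := by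
    have a1 : HasDerivAt (fun s => φ r + Real.exp (-κ * s) * ψ r) (-κ * (e * ψ r)) t := by
      have := ((((hasDerivAt_id t).const_mul (-κ)).exp).mul_const (ψ r)).const_add (φ r)
      refine HasDerivAt.congr_deriv this ?_
      simp [he]; ring
    have a2 : HasDerivAt (fun s => (1 - δ * Real.exp (c * s) * (1 + r ^ 2)) ^ 2 - δ)
        (-(2 * (1 - Q * (1 + r ^ 2)) * (c * (Q * (1 + r ^ 2))))) t := by
      have := (((((((hasDerivAt_id t).const_mul c).exp).const_mul δ).mul_const
        (1 + r ^ 2)).const_sub 1).pow 2).sub_const δ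
      refine HasDerivAt.congr_deriv this ?_
      rw [hQd]; simp only [id, show (2 - 1 : ℕ) = 1 from rfl, pow_one]; push_cast; ring
    exact a1.mul a2
  have hzt2 := (Real.hasDerivAt_rpow_const (x := auxZ φ ψ κ c δ r t) (p := p) (Or.inr hp.le)).comp t hzt
  have hle := aux_left_deriv (hvt.sub hzt2) (by simp [heq]) (by
    filter_upwards [htm, self_mem_nhdsWithin] with s h1 h2
    have h2' : s < t := h2
    simp only [Pi.sub_apply, Function.comp]
    rw [sub_nonneg]
    apply Real.rpow_le_rpow _ h1 (by linarith)
    unfold auxZ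
    apply mul_nonneg
    · have := Real.exp_pos (-κ * s); positivity
    · have b1 : Real.exp (c * s) ≤ Real.exp (c * t) := Real.exp_le_exp.2 (mul_le_mul_of_nonneg_left h2'.le hc.le)
      have b2 : δ * Real.exp (c * s) * (1 + r ^ 2) ≤ Q * (1 + r ^ 2) := by
        apply mul_le_mul_of_nonneg_right _ (by positivity)
        exact mul_le_mul_of_nonneg_left b1 hδ.le
      have b3 : (1 - Q * (1 + r ^ 2)) ^ 2 ≤ (1 - δ * Real.exp (c * s) * (1 + r ^ 2)) ^ 2 :=
        pow_le_pow_left₀ (by linarith) (by linarith) 2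
      have b4 : 0 ≤ (1 - Q * (1 + r ^ 2)) ^ 2 - δ := hmr
      linarith)
  rw [hZ] at hle
  have hpde := hv.pde r hr t ht
  rw [hpde] at hle
  -- φ' ≤ 0
  have hφ' : deriv φ r ≤ 0 := by
    have := aux_right_deriv (hd1 r hr).neg.hasDerivWithinAt (by
      filter_upwards [self_mem_nhdsWithin] with s hs
      have hs' : r < s := hs
      simp only [Pi.neg_apply, neg_le_neg_iff]
      exact (hφ.anti hr.le (hr.le.trans hs'.le) hs').le)
    linarith
  have hwle : e * ψ r ≤ z := by rw [hz]; linarith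
  have hφz : φ r ≤ z := by rw [hz]; linarith
  have hφzp : φ r ^ (p - 1) ≤ z ^ (p - 1) := Real.rpow_le_rpow hφr.le hφz (by linarith)
  refine hgap δ Q r z (e * ψ r) (deriv (deriv φ) r + e * d2 + ((n:ℝ) - 1) / r * (deriv φ r + e * χ1 r))
    (deriv φ r + e * χ1 r) hδ hδs ?_ hQ hr hwpos hwle ?_ ?_ ?_ ?_ ?_ hq hmr ?_
  · rw [hQd]
    have : 1 ≤ Real.exp (c * t) := Real.one_le_exp (by positivity)
    exact le_mul_of_one_le_right hδ.le this
  · exact (hY1 r hr.le).trans (mul_le_mul_of_nonneg_right hφzp (by positivity))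
  · refine le_trans ?_ (hY2 r hr.le)
    apply mul_le_mul_of_nonneg_right _ (by positivity)
    apply Real.rpow_le_rpow hzpos.le _ (by linarith)
    rw [hz]
    have := mul_le_of_le_one_left hψr.le he1
    linarith only [this]
  · have k1 := hφ.ode r hr
    have k2 := mul_le_mul_of_nonneg_left t5 hepos.le
    have k3 := aux_convex hp hφr hwpos.le
    rw [← hz] at k3
    have k4 : κ * p * φ r ^ (p - 1) * (e * ψ r) ≤ κ * p * z ^ (p - 1) * (e * ψ r) := by
      apply mul_le_mul_of_nonneg_right _ hwpos.le
      apply mul_le_mul_of_nonneg_left hφzp (by positivity)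
    rw [mul_zero] at k2
    linarith
  · have k1 := mul_le_mul_of_nonneg_left t6 hepos.le
    have k2 : 0 ≤ C3 * φ r := by positivity
    rw [hz]; linarith
  · intro h
    have := mul_nonpos_of_nonneg_of_nonpos hepos.le (t7 h)
    linarith
  · have k1 : deriv (fun ρ => v ρ t) r = (deriv φ r + e * χ1 r) * m r + z * m1 r := by linarith
    rw [k1, heq, hZ] at hle
    have k2 : ((n:ℝ) - 1) / r * (z * m1 r) = - (z * (4 * ((n:ℝ) - 1) * Q * (1 - Q * (1 + r ^ 2)))) := by
      simp only [hm1]; field_simp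
    change _ * m r + 2 * _ * m1 r + _ + (z * m r) ^ p ≤ p * (z * m r) ^ (p - 1) * (-κ * (e * ψ r) * m r + _)
    have k3 : -κ * (e * ψ r) * m r = -κ * (e * ψ r) * m r := rfl
    linarith

theorem aux_compare {n : ℕ} (hn : 10 < n) {p α a κ : ℝ} (hp : 1 < p) (hκ : 0 < κ)
    {φ ψ : ℝ → ℝ} (hφ : IsSteadyStateA n p α φ a)
    {v : ℝ → ℝ → ℝ} {v₀ : ℝ → ℝ} (hv : IsRadialSol n p v v₀)
    {c1 C2 C3 R2 c s₀ δ T : ℝ} (hC3 : 0 ≤ C3)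
    (hψc : Continuous ψ) (hψpos : ∀ r ≥ 0, 0 < ψ r)
    (hinit : ∀ r ≥ 0, φ r + ψ r ≤ v₀ r)
    {e0 : ℝ} (he0 : 0 < e0) (hψ0 : ψ 0 = e0)
    (hψe : ∀ᶠ s in nhdsWithin 0 (Set.Ioi 0), e0 * (1 + s) ≤ ψ s)
    (hY1 : ∀ r ≥ 0, c1 ≤ φ r ^ (p - 1) * (1 + r ^ 2))
    (hY2 : ∀ r ≥ 0, (φ r + ψ r) ^ (p - 1) * (1 + r ^ 2) ≤ C2)
    (htest : auxTest n (fun r => (1 + κ) * p * φ r ^ (p - 1)) ψ C3 R2)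
    (hgap : ∀ δ Q r z w Lap zr : ℝ, 0 < δ → δ ≤ s₀ → δ ≤ Q →
      Q * (1 + R2 ^ 2) ≤ 1 / 2 → 0 < r → 0 < w → w ≤ z →
      c1 ≤ z ^ (p - 1) * (1 + r ^ 2) → z ^ (p - 1) * (1 + r ^ 2) ≤ C2 →
      -z ^ p - κ * p * z ^ (p - 1) * w ≤ Lap → zr ≤ C3 * z → (R2 ≤ r → zr ≤ 0) →
      Q * (1 + r ^ 2) < 1 → 0 ≤ (1 - Q * (1 + r ^ 2)) ^ 2 - δ →
      Lap * ((1 - Q * (1 + r ^ 2)) ^ 2 - δ) + 2 * zr * (-(4 * (1 - Q * (1 + r ^ 2)) * (Q * r)))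
        + z * (8 * (Q * r) ^ 2 - 4 * n * Q * (1 - Q * (1 + r ^ 2)))
        + (z * ((1 - Q * (1 + r ^ 2)) ^ 2 - δ)) ^ p ≤
        p * (z * ((1 - Q * (1 + r ^ 2)) ^ 2 - δ)) ^ (p - 1) *
          (-κ * w * ((1 - Q * (1 + r ^ 2)) ^ 2 - δ)
            + z * (-(2 * (1 - Q * (1 + r ^ 2)) * (c * (Q * (1 + r ^ 2)))))) → False)
    (hδ : 0 < δ) (hδs : δ ≤ s₀) (hδ4 : δ < 1 / 4) (hc : 0 < c) (hT : 0 ≤ T)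
    (hQ : δ * Real.exp (c * T) * (1 + R2 ^ 2) ≤ 1 / 2) :
    auxZ φ ψ κ c δ 0 T ≤ v 0 T := by
  by_contra hcon
  rw [not_le] at hcon
  set q : ℝ × ℝ → ℝ := fun x => δ * Real.exp (c * x.2) * (1 + x.1 ^ 2) with hq
  have hqc : Continuous q := by simp only [hq]; fun_prop
  set Z : ℝ × ℝ → ℝ := fun x => auxZ φ ψ κ c δ x.1 x.2 with hZ
  have hZc : ContinuousOn Z (Set.Ici 0 ×ˢ Set.Ici 0) := by
    have h1 : ContinuousOn (fun x : ℝ × ℝ => φ x.1) (Set.Ici 0 ×ˢ Set.Ici 0) :=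
      hφ.cont.comp continuous_fst.continuousOn (fun x hx => hx.1)
    have h2 : Continuous (fun x : ℝ × ℝ => Real.exp (-κ * x.2) * ψ x.1) := by fun_prop
    have h3 : Continuous (fun x : ℝ × ℝ => (1 - q x) ^ 2 - δ) := by fun_prop
    exact (h1.add h2.continuousOn).mul h3.continuousOn
  have hzpos : ∀ r ≥ 0, ∀ t, 0 < φ r + Real.exp (-κ * t) * ψ r := fun r hr t => by
    have h1 := hφ.pos r hr
    have h2 := hψpos r hr
    have h3 := Real.exp_pos (-κ * t)
    positivity
  have hexp1 : ∀ t ≥ 0, 1 ≤ Real.exp (c * t) := fun t ht => Real.one_le_exp (by positivity)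
  have hrb : ∀ r ≥ 0, ∀ t ≥ 0, q (r, t) ≤ 1 → r ≤ 1 / δ := fun r hr t ht h => by
    have h1 : δ * 1 * (1 + r ^ 2) ≤ δ * Real.exp (c * t) * (1 + r ^ 2) :=
      mul_le_mul_of_nonneg_right (mul_le_mul_of_nonneg_left (hexp1 t ht) hδ.le) (by positivity)
    have h2 : δ * r ≤ δ * 1 * (1 + r ^ 2) := by nlinarith only [hδ, sq_nonneg (r - 1), sq_nonneg r, hr]
    rw [le_div_iff₀ hδ]
    simp only [hq] at h
    linarith
  set K : Set (ℝ × ℝ) := Set.Icc 0 (1 / δ) ×ˢ Set.Icc 0 T with hK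
  have hKc : IsCompact K := isCompact_Icc.prod isCompact_Icc
  have hKs : K ⊆ Set.Ici 0 ×ˢ Set.Ici 0 := fun x hx => ⟨hx.1.1, hx.2.1⟩
  set S : Set (ℝ × ℝ) := K ∩ {x | q x ≤ 1 ∧ v x.1 x.2 ≤ Z x} with hS
  have hSc : IsCompact S := by
    have h1 : IsClosed (K ∩ (fun x => (q x, Z x - v x.1 x.2)) ⁻¹' (Set.Iic 1 ×ˢ Set.Ici 0)) := by
      apply ContinuousOn.preimage_isClosed_of_isClosed _ hKc.isClosed (isClosed_Iic.prod isClosed_Ici)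
      exact hqc.continuousOn.prodMk ((hZc.mono hKs).sub (hv.cont.mono hKs))
    have h2 : S = K ∩ (fun x => (q x, Z x - v x.1 x.2)) ⁻¹' (Set.Iic 1 ×ˢ Set.Ici 0) := by
      ext x; simp [hS]
    rw [h2]
    exact hKc.of_isClosed_subset h1 Set.inter_subset_left
  have hQ1 : ∀ t ≤ T, δ * Real.exp (c * t) ≤ 1 / 2 ∧
      δ * Real.exp (c * t) * (1 + R2 ^ 2) ≤ 1 / 2 := fun t ht => by
    have h1 : Real.exp (c * t) ≤ Real.exp (c * T) :=
      Real.exp_le_exp.2 (mul_le_mul_of_nonneg_left ht hc.le)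
    have h2 : δ * Real.exp (c * t) ≤ δ * Real.exp (c * T) := mul_le_mul_of_nonneg_left h1 hδ.le
    have h3 := mul_le_mul_of_nonneg_right h2 (show 0 ≤ 1 + R2 ^ 2 by positivity)
    have h4 : 0 < δ * Real.exp (c * t) := by positivity
    refine ⟨?_, by linarith⟩
    nlinarith only [h3, hQ, h4, mul_nonneg h4.le (sq_nonneg R2)]
  have hSne : S.Nonempty := by
    refine ⟨(0, T), ⟨⟨by simp; positivity, by simpa using hT⟩, ?_, hcon.le⟩⟩
    have := (hQ1 T le_rfl).1
    simp only [hq]; linarith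
  obtain ⟨⟨r, t⟩, hx, hmin⟩ := hSc.exists_isMinOn hSne continuous_snd.continuousOn
  obtain ⟨⟨⟨hr0, hr1⟩, ⟨ht0, htT⟩⟩, hx1, hx2⟩ := hx
  simp only at hr0 hr1 ht0 htT hx1 hx2
  -- strict before t
  have hbefore : ∀ s ≥ 0, ∀ τ ≥ 0, τ < t → q (s, τ) ≤ 1 → Z (s, τ) < v s τ := by
    intro s hs τ hτ hτt hqs
    by_contra hh
    rw [not_lt] at hh
    have : (s, τ) ∈ S := ⟨⟨⟨hs, hrb s hs τ hτ hqs⟩, ⟨hτ, hτt.le.trans htT⟩⟩, hqs, hh⟩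
    have := hmin this
    simp only [Set.mem_ofPred_eq] at this
    linarith
  have htpos : 0 < t := by
    rcases ht0.lt_or_eq with h | h
    · exact h
    exfalso
    rw [← h] at hx1 hx2
    rw [hv.init r hr0] at hx2
    have h1 := hinit r hr0
    have h2 := hzpos r hr0 0
    simp only [hZ, auxZ] at hx2
    have h3 : 0 < q (r, 0) := by simp only [hq]; positivity
    have h4 : (1 - q (r, 0)) ^ 2 ≤ 1 := by
      apply pow_le_one₀ <;> linarith
    have h5 := mul_lt_mul_of_pos_left (show (1 - q (r, 0)) ^ 2 - δ < 1 by linarith) h2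
    simp only [hq] at h5
    simp only [mul_zero, Real.exp_zero, one_mul, mul_one] at h5 hx2
    linarith
  have hqlt : q (r, t) < 1 := by
    rcases hx1.lt_or_eq with h | h
    · exact h
    exfalso
    have h1 := hv.nonneg r hr0 t ht0
    have h2 : Z (r, t) = (φ r + Real.exp (-κ * t) * ψ r) * ((1 - q (r, t)) ^ 2 - δ) := rfl
    rw [h] at h2
    have h3 := mul_pos (hzpos r hr0 t) hδ
    linarith
  have hqmono : ∀ s, ∀ τ ≤ t, q (s, τ) ≤ q (s, t) := fun s τ h => by
    simp only [hq]
    apply mul_le_mul_of_nonneg_right _ (by positivity)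
    apply mul_le_mul_of_nonneg_left _ hδ.le
    exact Real.exp_le_exp.2 (mul_le_mul_of_nonneg_left h hc.le)
  have hev0 : ∀ᶠ τ in nhdsWithin t (Set.Iio t), 0 ≤ τ ∧ τ < t := by
    filter_upwards [nhdsWithin_le_nhds (Ioi_mem_nhds htpos), self_mem_nhdsWithin] with τ h1 h2
    exact ⟨le_of_lt h1, h2⟩
  have hat : ∀ s ≥ 0, q (s, t) ≤ 1 → Z (s, t) ≤ v s t := by
    intro s hs hqs
    have hcur : ContinuousOn (fun τ : ℝ => v s τ - Z (s, τ)) (Set.Ici 0) := by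
      have := hv.cont.sub hZc
      exact this.comp (f := fun τ : ℝ => (s, τ)) (by fun_prop) (fun τ hτ => ⟨hs, hτ⟩)
    have hca : ContinuousAt (fun τ : ℝ => v s τ - Z (s, τ)) t := hcur.continuousAt (Ici_mem_nhds htpos)
    have := ge_of_tendsto (hca.tendsto.mono_left (nhdsWithin_le_nhds (s := Set.Iio t))) (b := 0) (by
      filter_upwards [hev0] with τ hτ
      have := hbefore s hs τ hτ.1 hτ.2 ((hqmono s τ hτ.2.le).trans hqs)
      linarith)
    linarith
  have heq : v r t = auxZ φ ψ κ c δ r t := le_antisymm hx2 (hat r hr0 hx1)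
  have hqev : ∀ᶠ s in nhds r, q (s, t) < 1 := by
    have : ContinuousAt (fun s => q (s, t)) r := by
      simp only [hq]; fun_prop
    exact this.eventually (gt_mem_nhds hqlt)
  rcases hr0.lt_or_eq with hr | hr
  · refine aux_touch1 hp hκ hφ hv hC3 hψpos hY1 hY2 htest hgap hδ hδs hc (hQ1 t htT).2 htpos hr hqlt
      heq ?_ ?_
    · filter_upwards [hqev, Ioi_mem_nhds hr] with s h1 h2
      exact hat s (le_of_lt h2) h1.le
    · filter_upwards [hev0] with τ hτ
      exact (hbefore r hr0 τ hτ.1 hτ.2 ((hqmono r τ hτ.2.le).trans hx1)).le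
  · subst hr
    refine aux_touch0 hn hp hφ hv he0 hψ0 hψe hδ hδ4 (hQ1 t htT).1 htpos heq ?_
    filter_upwards [nhdsWithin_le_nhds hqev, self_mem_nhdsWithin] with s h1 h2
    exact hat s (le_of_lt h2) h1.le

/-- Lemma 5.1: let `n > 10`, `p > p_c`, `α > 0`, and let `v₀` be continuous
with `0 ≤ v₀(r) ≤ L r^{−ν}` for `r > 0` and `v₀(r) ≥ φ_α(r) + b(r+1)^{−γ}` for all
`r ≥ 0`, with `b > 0` and `γ ∈ (ν+λ₁, (n−2)/2)`. Then there is `c > 0` such that every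
bounded classical radial solution `v` with initial data `v₀` satisfies
`v(0,t) − φ_α(0) ≥ c e^{−κ(γ)t}` for all `t ≥ 0`. -/
theorem radial_lower_rate_from_above (n : ℕ) (hn : 10 < n) (p α b γ : ℝ)
    (hp : pc n < p) (hα : 0 < α) (hb : 0 < b)
    (hγ : γ ∈ Set.Ioo (nuExp p + lam1 n p) (((n : ℝ) - 2) / 2))
    (φ : ℝ → ℝ) (a : ℝ) (hφ : IsSteadyStateA n p α φ a)
    (v₀ : ℝ → ℝ) (hv₀cont : ContinuousOn v₀ (Set.Ici 0))
    (hv₀nonneg : ∀ r > (0 : ℝ), 0 ≤ v₀ r)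
    (hv₀upper : ∀ r > (0 : ℝ), v₀ r ≤ Lconst n p * r ^ (-nuExp p))
    (hv₀low : ∀ r ≥ (0 : ℝ), φ r + b * (r + 1) ^ (-γ) ≤ v₀ r) :
    ∃ c > 0, ∀ v : ℝ → ℝ → ℝ, IsRadialSol n p v v₀ →
      ∀ t ≥ (0 : ℝ), c * Real.exp (-(kappaOf n p γ) * t) ≤ v 0 t - φ 0 := by
  obtain ⟨hp1, hν, hν2⟩ := aux_params n hn p hp
  obtain ⟨hl, hL, hpL, hpLpos, hκ, hκe, hνγ, hpν⟩ := aux_params2 n hn p γ hp hγ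
  set κ := kappaOf n p γ with hκd
  obtain ⟨B, hB, R, hR, hasym⟩ := aux_phi_asym hp1 hL hl hpν hφ
  obtain ⟨c1, hc1, hY1⟩ := aux_phi_c1 hp1 hL hl hpν hφ
  obtain ⟨C, hC, hup⟩ := aux_phi_upper hν hL hφ
  have hκp : 0 < (1 + κ) * p := by positivity
  obtain ⟨ψ, hψc, hψpos, hψb, ⟨e, he, hψ0, hψe⟩, C3, hC3, R2, hR2, htest⟩ :=
    aux_psi (n : ℝ) γ (lam1 n p) B R b (hν.trans hνγ) hγ.2 hl hB hR hb
      (fun r => (1 + κ) * p * φ r ^ (p - 1))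
      (fun r hr => by
        have := hφ.pos r hr.le
        positivity)
      (fun r hr => by
        have h1 := mul_le_mul_of_nonneg_left (hasym r hr) hκp.le
        rw [← hκe]
        refine le_trans (le_of_eq ?_) h1
        ring)
  have hinit : ∀ r ≥ 0, φ r + ψ r ≤ v₀ r := fun r hr => by
    linarith [hψb r hr, hv₀low r hr]
  have hY2 : ∀ r ≥ 0, (φ r + ψ r) ^ (p - 1) * (1 + r ^ 2) ≤ (C + b) ^ (p - 1) := by
    intro r hr
    have h0 : 0 < 1 + r := by linarith
    have h1 : ψ r ≤ b * (1 + r) ^ (-nuExp p) := by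
      refine (hψb r hr).trans ?_
      rw [add_comm r 1]
      apply mul_le_mul_of_nonneg_left _ hb.le
      exact Real.rpow_le_rpow_of_exponent_le (by linarith) (by linarith)
    have h2 : φ r + ψ r ≤ (C + b) * (1 + r) ^ (-nuExp p) := by
      rw [add_mul]; exact add_le_add (hup r hr) h1
    have h3 : (φ r + ψ r) ^ (p - 1) ≤ ((C + b) * (1 + r) ^ (-nuExp p)) ^ (p - 1) :=
      Real.rpow_le_rpow (add_pos (hφ.pos r hr) (hψpos r hr)).le h2 (by linarith)
    rw [Real.mul_rpow (by positivity) (by positivity), ← Real.rpow_mul h0.le,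
      show -nuExp p * (p - 1) = -(2 : ℝ) by linarith, Real.rpow_neg h0.le, Real.rpow_two] at h3
    have h4 := mul_le_mul_of_nonneg_right h3 (show 0 ≤ 1 + r ^ 2 by positivity)
    refine h4.trans ?_
    rw [mul_assoc]
    apply mul_le_of_le_one_right (by positivity)
    rw [inv_mul_le_iff₀ (by positivity)]
    nlinarith only [hr]
  obtain ⟨c, hc, s₀, hs₀, hgap⟩ := aux_gap (n : ℝ) p κ c1 ((C + b) ^ (p - 1)) C3 R2
    (by positivity) hp1 hκ hc1 (by positivity) hC3 hR2
  refine ⟨e, he, fun v hv T hT => ?_⟩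
  have hcmp : ∀ᶠ δ in nhdsWithin (0 : ℝ) (Set.Ioi 0), auxZ φ ψ κ c δ 0 T ≤ v 0 T := by
    have hQ : ∀ᶠ δ in nhds (0 : ℝ), δ * Real.exp (c * T) * (1 + R2 ^ 2) < 1 / 2 := by
      have : ContinuousAt (fun δ : ℝ => δ * Real.exp (c * T) * (1 + R2 ^ 2)) 0 := by fun_prop
      apply this.eventually (gt_mem_nhds _)
      norm_num
    filter_upwards [nhdsWithin_le_nhds hQ, nhdsWithin_le_nhds (Iio_mem_nhds hs₀),
      nhdsWithin_le_nhds (Iio_mem_nhds (show (0 : ℝ) < 1 / 4 by norm_num)),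
      self_mem_nhdsWithin] with δ h1 h2 h3 h4
    exact aux_compare hn hp1 hκ hφ hv hC3 hψc hψpos hinit he hψ0 hψe hY1 hY2 htest hgap h4
      (le_of_lt h2) h3 hc hT h1.le
  have hcont : ContinuousAt (fun δ => auxZ φ ψ κ c δ 0 T) 0 := by
    unfold auxZ; fun_prop
  have := le_of_tendsto (hcont.tendsto.mono_left (nhdsWithin_le_nhds (s := Set.Ioi 0))) hcmp
  simp only [auxZ, hψ0] at this
  norm_num at this
  rw [neg_mul]
  linarith
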